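/- Let A = {b_1 < ⋯ < b_t < l+1 < l+2 < ⋯ < s} be a lacunary alphabet of positive integers with 1 ≤ t ≤ l < s and b_t ≤ l. Then for all sufficiently large s, there exists a sequence of words w_k over A whose multiplicities μ(w_k) tend to infinity, where μ(w) is the number of permutations u of w (identified with reversals) satisfying K(u) = K(w). -/

import Mathlib

open Filter

/-- The regular continuant of a finite word of positive integers. -/
def K : List ℕ → ℕ
  | [] => 1
  | [a] => a
  | a :: b :: t => a * K (b :: t) + K t

/-- The set of permutations of `w`, with each word identified with its reversal. -/
def classes (w : List ℕ) : Finset (Finset (List ℕ)) :=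
  w.permutations.toFinset.image (fun u => ({u, u.reverse} : Finset (List ℕ)))

/-- The multiplicity `μ(w)`: the number of permutations of `w` (up to reversal)
whose continuant equals `K w`. -/
def mult (w : List ℕ) : ℕ :=
  ((classes w).filter (fun c => ∃ u ∈ c, K u = K w)).card

theorem K_le_prod_map_succ : ∀ w : List ℕ, K w ≤ (w.map (· + 1)).prod
  | [] => by simp [K]
  | [a] => by simp [K]
  | a :: b :: t => by
    have h₁ := K_le_prod_map_succ (b :: t)
    have h₂ := K_le_prod_map_succ t
    simp only [K, List.map_cons, List.prod_cons] at h₁ ⊢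
    nlinarith [Nat.mul_le_mul_left a h₁, Nat.zero_le (b * (t.map (· + 1)).prod)]

theorem prod_map_succ_pos (w : List ℕ) : 0 < (w.map (· + 1)).prod :=
  List.prod_pos fun a ha => by
    obtain ⟨b, -, rfl⟩ := List.mem_map.1 ha
    exact b.succ_pos

theorem card_permutations_filter_K_le (w : List ℕ) :
    (w.permutations.toFinset.filter (fun u => K u = K w)).card ≤ 2 * mult w := by
  have hsub : w.permutations.toFinset.filter (fun u => K u = K w) ⊆
      ((classes w).filter (fun c => ∃ u ∈ c, K u = K w)).biUnion id := by
    intro u hu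
    obtain ⟨hu, hK⟩ := Finset.mem_filter.1 hu
    refine Finset.mem_biUnion.2 ⟨{u, u.reverse}, Finset.mem_filter.2 ⟨?_, u, ?_, hK⟩, ?_⟩
    · exact Finset.mem_image_of_mem _ hu
    · simp
    · simp
  refine (Finset.card_le_card hsub).trans ((Finset.card_biUnion_le_card_mul _ _ 2 ?_).trans_eq
    (mul_comm _ _))
  intro c hc
  obtain ⟨u, -, rfl⟩ := Finset.mem_image.1 (Finset.mem_filter.1 hc).1
  exact Finset.card_le_two

/-- If every rearrangement of `w` has multiplicity at most `k`, pigeonholing on the values of `K`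
bounds the number of rearrangements. -/
theorem card_permutations_le {w : List ℕ} {k : ℕ} (h : ∀ u, u.Perm w → mult u ≤ k) :
    w.permutations.toFinset.card ≤ 4 * k * (w.map (· + 1)).prod := by
  set V := (w.map (· + 1)).prod with hV
  have hVpos : 0 < V := prod_map_succ_pos w
  have hmaps : ∀ u ∈ w.permutations.toFinset, K u ∈ Finset.range (V + 1) := by
    intro u hu
    have hp : u.Perm w := by simpa using hu
    rw [Finset.mem_range, Nat.lt_succ_iff, hV, ← (hp.map (· + 1)).prod_eq]
    exact K_le_prod_map_succ u
  have hfib : ∀ v ∈ Finset.range (V + 1),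
      (w.permutations.toFinset.filter (fun u => K u = v)).card ≤ 2 * k := by
    intro v _
    rcases (w.permutations.toFinset.filter (fun u => K u = v)).eq_empty_or_nonempty with
      h0 | ⟨u, hu⟩
    · simp [h0]
    obtain ⟨hu, rfl⟩ := Finset.mem_filter.1 hu
    have hp : u.Perm w := by simpa using hu
    have heq : w.permutations.toFinset = u.permutations.toFinset := by
      ext x
      simpa using ⟨fun hx => hx.trans hp.symm, fun hx => hx.trans hp⟩
    rw [heq]
    exact (card_permutations_filter_K_le u).trans (Nat.mul_le_mul_left 2 (h u hp))
  have := Finset.card_le_mul_card_image_of_maps_to hmaps (2 * k) hfib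
  rw [Finset.card_range] at this
  nlinarith [Nat.mul_le_mul_left k hVpos]

/-- If all words over `A` have multiplicity at most `k`, the powers of `∑ a ∈ A, 1 / (a + 1)` grow
at most polynomially. -/
theorem sum_inv_succ_pow_le {A : Finset ℕ} {k : ℕ}
    (h : ∀ w : List ℕ, (∀ x ∈ w, x ∈ A) → mult w ≤ k) (N : ℕ) :
    (∑ a ∈ A, ((a : ℝ) + 1)⁻¹) ^ N ≤ 4 * k * ((N : ℝ) + 1) ^ A.card := by
  classical
  set M : (Fin N → ℕ) → Multiset ℕ := fun f => (List.ofFn f : Multiset ℕ) with hM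
  set S := Fintype.piFinset (fun _ : Fin N => A) with hS
  have hmaps : ∀ f ∈ S, M f ∈ Finset.Iic (N • A.val) := by
    intro f hf
    rw [hS, Fintype.mem_piFinset] at hf
    rw [Finset.mem_Iic, Multiset.le_iff_count]
    intro a
    rw [Multiset.count_nsmul, hM, Multiset.coe_count]
    by_cases ha : a ∈ A
    · rw [Multiset.count_eq_one_of_mem A.nodup ha, mul_one]
      exact List.count_le_length.trans (by simp)
    · rw [List.count_eq_zero_of_not_mem]
      · exact Nat.zero_le _
      · rintro hx
        obtain ⟨i, rfl⟩ := (List.mem_ofFn' _ _).1 hx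
        exact ha (hf i)
  have hcard : ((Finset.Iic (N • A.val)).card : ℝ) ≤ ((N : ℝ) + 1) ^ A.card := by
    have hsub : (N • A.val).toFinset ⊆ A := fun a ha =>
      Multiset.mem_of_mem_nsmul (Multiset.mem_toFinset.1 ha)
    have hle : (Finset.Iic (N • A.val)).card ≤ (N + 1) ^ A.card := by
      rw [Multiset.card_Iic]
      refine (Finset.prod_le_pow_card _ _ (N + 1) fun a ha => ?_).trans
        (Nat.pow_le_pow_right N.succ_pos (Finset.card_le_card hsub))
      simp [Multiset.count_eq_one_of_mem A.nodup (hsub ha)]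
    exact_mod_cast hle
  have hfib : ∀ m ∈ Finset.Iic (N • A.val),
      ∑ f ∈ S with M f = m, ∏ i, ((f i : ℝ) + 1)⁻¹ ≤ 4 * k := by
    intro m _
    rcases (S.filter (fun f => M f = m)).eq_empty_or_nonempty with h0 | ⟨g, hg⟩
    · simp [h0]
    obtain ⟨hgS, rfl⟩ := Finset.mem_filter.1 hg
    rw [hS, Fintype.mem_piFinset] at hgS
    set w := List.ofFn g with hw
    have hperm : ∀ f, M f = M g → (List.ofFn f).Perm w := fun f hf => Multiset.coe_eq_coe.1 hf
    have hprod : ∀ f, M f = M g →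
        ∏ i, ((f i : ℝ) + 1)⁻¹ = (((w.map (· + 1)).prod : ℕ) : ℝ)⁻¹ := by
      intro f hf
      rw [← ((hperm f hf).map (· + 1)).prod_eq, List.map_ofFn, List.prod_ofFn]
      simp [Finset.prod_inv_distrib]
    have hV : (0 : ℝ) < ((w.map (· + 1)).prod : ℕ) := by
      exact_mod_cast prod_map_succ_pos w
    rw [Finset.sum_congr rfl fun f hf => hprod f (Finset.mem_filter.1 hf).2, Finset.sum_const,
      nsmul_eq_mul, ← div_eq_mul_inv, div_le_iff₀ hV]
    have hle : (S.filter (fun f => M f = M g)).card ≤ w.permutations.toFinset.card := by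
      refine Finset.card_le_card_of_injOn List.ofFn ?_ List.ofFn_injective.injOn
      intro f hf
      simpa using hperm f (Finset.mem_filter.1 hf).2
    have hwk := card_permutations_le (w := w) (k := k) fun u hu => h u fun x hx => by
      obtain ⟨i, rfl⟩ := (List.mem_ofFn' _ _).1 (hu.mem_iff.1 hx)
      exact hgS i
    exact_mod_cast hle.trans hwk
  calc (∑ a ∈ A, ((a : ℝ) + 1)⁻¹) ^ N
      = ∑ f ∈ S, ∏ i, ((f i : ℝ) + 1)⁻¹ := by
        simpa using Finset.prod_univ_sum (fun _ : Fin N => A) (fun _ a => ((a : ℝ) + 1)⁻¹)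
    _ = ∑ m ∈ Finset.Iic (N • A.val), ∑ f ∈ S with M f = m, ∏ i, ((f i : ℝ) + 1)⁻¹ :=
        (Finset.sum_fiberwise_of_maps_to hmaps _).symm
    _ ≤ (Finset.Iic (N • A.val)).card • (4 * k : ℝ) := Finset.sum_le_card_nsmul _ _ _ hfib
    _ ≤ 4 * k * ((N : ℝ) + 1) ^ A.card := by
        rw [nsmul_eq_mul, mul_comm]
        gcongr

theorem exists_lt_mult {A : Finset ℕ} (hA : 1 < ∑ a ∈ A, ((a : ℝ) + 1)⁻¹) (k : ℕ) :
    ∃ w : List ℕ, (∀ x ∈ w, x ∈ A) ∧ k < mult w := by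
  by_contra! h
  set c := ∑ a ∈ A, ((a : ℝ) + 1)⁻¹
  have hlim := ((tendsto_pow_const_div_const_pow_of_one_lt A.card hA).comp
    (tendsto_add_atTop_nat 1)).const_mul (4 * k * c)
  rw [mul_zero] at hlim
  obtain ⟨N, hN⟩ := (hlim.eventually_lt_const one_pos).exists
  have hle := sum_inv_succ_pow_le h N
  have hc : 0 < c := one_pos.trans hA
  have : 4 * k * c * (((N + 1 : ℕ) : ℝ) ^ A.card / c ^ (N + 1)) =
      4 * k * ((N : ℝ) + 1) ^ A.card / c ^ N := by
    push_cast
    field_simp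
    ring
  rw [Function.comp_apply, this, div_lt_one (by positivity)] at hN
  exact absurd hle hN.not_ge

theorem eventually_one_lt_sum_Icc_inv_succ (l : ℕ) :
    ∀ᶠ s in atTop, 1 < ∑ a ∈ Finset.Icc (l + 1) s, ((a : ℝ) + 1)⁻¹ := by
  have hlim := (tendsto_add_atTop_iff_nat 1).2 Real.tendsto_sum_range_one_div_nat_succ_atTop
  filter_upwards [hlim.eventually_gt_atTop (1 + ∑ a ∈ Finset.range (l + 1), (1 / ((a : ℝ) + 1))),
    eventually_ge_atTop l] with s hs hls
  have := Finset.sum_range_add_sum_Ico (fun a : ℕ => 1 / ((a : ℝ) + 1)) (Nat.succ_le_succ hls)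
  have hIcc : Finset.Icc (l + 1) s = Finset.Ico (l + 1) (s + 1) := by ext; simp
  simp only [one_div, Nat.succ_eq_add_one] at this hs
  rw [hIcc]
  linarith

/-- Main Theorem: for a lacunary alphabet `A = {b₁ < ⋯ < b_t < l+1 < ⋯ < s}` with
`1 ≤ t ≤ l < s`, `b_t ≤ l`, and `s` sufficiently large, there is a sequence of words
over `A` with multiplicities tending to infinity. -/
theorem lacunary_multiplicity_unbounded (t l : ℕ) (ht : 1 ≤ t) (htl : t ≤ l)
    (b : Fin t → ℕ) (hb : StrictMono b) (hb1 : ∀ i, 1 ≤ b i) (hbl : ∀ i, b i ≤ l) :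
    ∃ s₀ : ℕ, ∀ s : ℕ, s₀ ≤ s → l < s →
      ∃ w : ℕ → List ℕ,
        (∀ k, w k ≠ [] ∧ ∀ x ∈ w k, x ∈ Set.range b ∪ Set.Icc (l + 1) s) ∧
        Tendsto (fun k => mult (w k)) atTop atTop := by
  obtain ⟨s₀, hs₀⟩ := eventually_atTop.1 (eventually_one_lt_sum_Icc_inv_succ l)
  refine ⟨s₀, fun s hs _ => ?_⟩
  choose w hwA hw using fun k : ℕ => exists_lt_mult (hs₀ s hs) (max k (mult []))
  refine ⟨w, fun k => ⟨?_, fun x hx => ?_⟩, ?_⟩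
  · intro h0
    have := hw k
    rw [h0] at this
    exact absurd this (le_max_right _ _).not_gt
  · exact Or.inr (by simpa using hwA k x hx)
  · exact tendsto_atTop_mono (fun k => (le_max_left _ _).trans (hw k).le) tendsto_id
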